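/- Directional dichotomy: For all reals δ > 0 and ε > 0 there exist a positive integer M = M(d, δ, ε) and a positive real κ = κ(d, δ, ε) such that the following holds. If T is an ergodic measure-preserving ℤ^d-action on a probability space (X, μ), A ⊆ X is measurable with μ(A) ≥ δ, and σ is the spectral measure of A, and if σ(Rat(M)) < κ, then there exists a primitive vector v ∈ ℤ^d for which μ(⋃_{n∈ℤ} (T^{nv})⁻¹A) > 1 − ε. -/

import Mathlib

open MeasureTheory Filter
open scoped symmDiff

/-- A measure-preserving `ℤ^d`-action on `(X, μ)`: a family of measurable maps
`(T v)_{v ∈ ℤ^d}` with `T 0 = id`, `T (v+w) = T v ∘ T w`, each preserving `μ`. -/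
def IsMPAction {X : Type} [MeasurableSpace X] (d : ℕ)
    (T : (Fin d → ℤ) → X → X) (μ : Measure X) : Prop :=
  T 0 = id ∧ (∀ v w, T (v + w) = T v ∘ T w) ∧ ∀ v, MeasurePreserving (T v) μ μ

/-- The action is ergodic: every measurable set invariant (up to null sets) under
all the maps `T v` has measure `0` or `1`. -/
def IsErgodicAction {X : Type} [MeasurableSpace X] (d : ℕ)
    (T : (Fin d → ℤ) → X → X) (μ : Measure X) : Prop :=
  IsMPAction d T μ ∧
    ∀ A : Set X, MeasurableSet A →
      (∀ v, μ ((T v ⁻¹' A) ∆ A) = 0) → μ A = 0 ∨ μ A = 1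

/-- A vector `v ∈ ℤ^d` is primitive if the gcd of its components is `1`. -/
def IsPrimitiveVec {d : ℕ} (v : Fin d → ℤ) : Prop := Finset.univ.gcd v = 1

/-- `σ` is the spectral measure of the set `A`: a finite Borel measure on the torus
`𝕋^d = (ℝ/ℤ)^d` with `μ(A ∩ (T v)⁻¹ A) = ∫ e(v·α) dσ(α)` for all `v ∈ ℤ^d`. -/
def IsSpectralMeasure {X : Type} [MeasurableSpace X] (d : ℕ)
    (T : (Fin d → ℤ) → X → X) (μ : Measure X) (A : Set X)
    (σ : Measure (Fin d → AddCircle (1 : ℝ))) : Prop :=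
  ∀ v : Fin d → ℤ,
    ((μ (A ∩ T v ⁻¹' A)).toReal : ℂ) =
      ∫ α, (AddCircle.toCircle (∑ i, (v i) • (α i)) : ℂ) ∂σ

/-- `Rat(M)`: the set of nonzero torsion points of `𝕋^d` of order at most `M`. -/
def ratTorsion (d M : ℕ) : Set (Fin d → AddCircle (1 : ℝ)) :=
  {α | α ≠ 0 ∧ ∃ q : ℕ, 1 ≤ q ∧ q ≤ M ∧ q • α = 0}

/-- The character `α ↦ e(v·α)` of the torus. -/
noncomputable def torusChar {d : ℕ} (v : Fin d → ℤ) (α : Fin d → AddCircle (1 : ℝ)) : ℂ :=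
  AddCircle.toCircle (∑ i, v i • α i)

section TorusChar

variable {d : ℕ}

lemma continuous_torusChar (v : Fin d → ℤ) : Continuous (torusChar v) := by
  unfold torusChar
  exact continuous_subtype_val.comp (AddCircle.continuous_toCircle.comp (by fun_prop))

lemma norm_torusChar (v : Fin d → ℤ) (α : Fin d → AddCircle (1 : ℝ)) : ‖torusChar v α‖ = 1 :=
  Circle.norm_coe _

lemma torusChar_zero_right (v : Fin d → ℤ) : torusChar v 0 = 1 := by
  simp [torusChar]

lemma torusChar_nsmul (n : ℕ) (v : Fin d → ℤ) (α : Fin d → AddCircle (1 : ℝ)) :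
    torusChar (n • v) α = torusChar v α ^ n := by
  have h : ∑ i, (n • v) i • α i = n • ∑ i, v i • α i := by
    simp [Finset.smul_sum, mul_smul]
  rw [torusChar, h, AddCircle.toCircle_nsmul, Circle.coe_pow, torusChar]

lemma conj_torusChar_mul_torusChar (v w : Fin d → ℤ) (α : Fin d → AddCircle (1 : ℝ)) :
    starRingEnd ℂ (torusChar v α) * torusChar w α = torusChar (w - v) α := by
  have h : ∑ i, (w - v) i • α i = -(∑ i, v i • α i) + ∑ i, w i • α i := by
    simp [sub_smul]; abel
  simp only [torusChar, h, AddCircle.toCircle_add, AddCircle.toCircle_neg, Circle.coe_mul,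
    Circle.coe_inv_eq_conj]

lemma torusChar_eq_one_iff (v : Fin d → ℤ) (α : Fin d → AddCircle (1 : ℝ)) :
    torusChar v α = 1 ↔ ∑ i, v i • α i = 0 := by
  rw [torusChar, ← Circle.coe_one, Circle.coe_inj, ← AddCircle.toCircle_zero,
    (AddCircle.injective_toCircle one_ne_zero).eq_iff]

lemma integrable_torusChar (v : Fin d → ℤ) (σ : Measure (Fin d → AddCircle (1 : ℝ)))
    [IsFiniteMeasure σ] : Integrable (torusChar v) σ :=
  .of_bound (continuous_torusChar v).aestronglyMeasurable 1
    (.of_forall fun α ↦ (norm_torusChar v α).le)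

/-- The annihilator `{α | v·α = 0}` of `v`. -/
def annihilator (v : Fin d → ℤ) : Set (Fin d → AddCircle (1 : ℝ)) :=
  {α | ∑ i, v i • α i = 0}

lemma isClosed_annihilator (v : Fin d → ℤ) : IsClosed (annihilator v) :=
  isClosed_eq (by fun_prop) continuous_const

end TorusChar

section Koopman

variable {X : Type} [MeasurableSpace X] {d : ℕ} {T : (Fin d → ℤ) → X → X} {μ : Measure X}
  {A : Set X}

lemma IsMPAction.measurableSet_preimage (hT : IsMPAction d T μ) (hA : MeasurableSet A)
    (v : Fin d → ℤ) : MeasurableSet (T v ⁻¹' A) :=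
  (hT.2.2 v).measurable hA

lemma IsMPAction.preimage_preimage (hT : IsMPAction d T μ) (v w : Fin d → ℤ) :
    T v ⁻¹' (T w ⁻¹' A) = T (v + w) ⁻¹' A := by
  rw [add_comm, hT.2.1, Set.preimage_comp]

lemma IsMPAction.measureReal_preimage_inter_preimage (hT : IsMPAction d T μ)
    (hA : MeasurableSet A) (v w : Fin d → ℤ) :
    μ.real (T v ⁻¹' A ∩ T w ⁻¹' A) = μ.real (A ∩ T (w - v) ⁻¹' A) := by
  have h : T v ⁻¹' A ∩ T w ⁻¹' A = T v ⁻¹' (A ∩ T (w - v) ⁻¹' A) := by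
    rw [Set.preimage_inter, hT.preimage_preimage, add_sub_cancel]
  rw [h, (hT.2.2 v).measureReal_preimage
    (hA.inter (hT.measurableSet_preimage hA _)).nullMeasurableSet]

/-- The translate `1_A ∘ T v` of the indicator function of `A` as an element of `L²`. -/
noncomputable def translatedIndicator [IsFiniteMeasure μ] (hT : IsMPAction d T μ)
    (hA : MeasurableSet A) (v : Fin d → ℤ) : Lp ℝ 2 μ :=
  indicatorConstLp 2 (hT.measurableSet_preimage hA v) (measure_ne_top μ _) 1

/-- The Koopman isometry `f ↦ f ∘ T v` of `L²`. -/
noncomputable def koopman (hT : IsMPAction d T μ) (v : Fin d → ℤ) : Lp ℝ 2 μ →ₗᵢ[ℝ] Lp ℝ 2 μ :=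
  Lp.compMeasurePreservingₗᵢ ℝ (T v) (hT.2.2 v)

variable [IsFiniteMeasure μ]

lemma koopman_translatedIndicator (hT : IsMPAction d T μ) (hA : MeasurableSet A)
    (v w : Fin d → ℤ) :
    koopman hT v (translatedIndicator hT hA w) = translatedIndicator hT hA (v + w) := by
  have h := Lp.indicatorConstLp_compMeasurePreserving (p := 2) (c := (1 : ℝ))
    (hT.measurableSet_preimage hA w) (measure_ne_top μ _) (hT.2.2 v)
  simp only [hT.preimage_preimage] at h
  exact h

lemma IsSpectralMeasure.norm_sum_sq (hT : IsMPAction d T μ) (hA : MeasurableSet A)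
    {σ : Measure (Fin d → AddCircle (1 : ℝ))} [IsFiniteMeasure σ]
    (hσ : IsSpectralMeasure d T μ A σ) {ι : Type*} (s : Finset ι) (c : ι → ℝ)
    (w : ι → Fin d → ℤ) :
    ‖∑ i ∈ s, c i • translatedIndicator hT hA (w i)‖ ^ 2 =
      ∫ α, ‖∑ i ∈ s, (c i : ℂ) * torusChar (w i) α‖ ^ 2 ∂σ := by
  have hpt (α : Fin d → AddCircle (1 : ℝ)) :
      ((‖∑ i ∈ s, (c i : ℂ) * torusChar (w i) α‖ ^ 2 : ℝ) : ℂ) =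
        ∑ i ∈ s, ∑ j ∈ s, (c i * c j : ℂ) * torusChar (w j - w i) α := by
    rw [Complex.ofReal_pow, ← Complex.conj_mul', map_sum, Finset.sum_mul_sum]
    refine Finset.sum_congr rfl fun i _ ↦ Finset.sum_congr rfl fun j _ ↦ ?_
    rw [← conj_torusChar_mul_torusChar, map_mul, Complex.conj_ofReal]
    ring
  have hint (i j : ι) : Integrable (fun α ↦ (c i * c j : ℂ) * torusChar (w j - w i) α) σ :=
    (integrable_torusChar _ σ).const_mul _
  rw [← Complex.ofReal_inj, ← integral_complex_ofReal]
  simp_rw [hpt]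
  rw [integral_finsetSum _ fun i _ ↦ integrable_finsetSum _ fun j _ ↦ hint i j,
    ← real_inner_self_eq_norm_sq, sum_inner]
  push_cast
  refine Finset.sum_congr rfl fun i _ ↦ ?_
  rw [integral_finsetSum _ fun j _ ↦ hint i j, inner_sum]
  push_cast
  refine Finset.sum_congr rfl fun j _ ↦ ?_
  rw [integral_const_mul, real_inner_smul_left, real_inner_smul_right, translatedIndicator,
    translatedIndicator, L2.real_inner_indicatorConstLp_one_indicatorConstLp_one,
    hT.measureReal_preimage_inter_preimage hA]
  have := hσ (w j - w i)
  rw [← measureReal_def] at this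
  push_cast
  rw [this]
  simp only [torusChar]
  ring

lemma tendsto_norm_average_sq (v : Fin d → ℤ) (α : Fin d → AddCircle (1 : ℝ)) :
    Tendsto (fun N : ℕ ↦ ‖∑ n ∈ Finset.range N, ((N : ℝ)⁻¹ : ℝ) * torusChar (n • v) α‖ ^ 2)
      atTop (nhds ((annihilator v).indicator 1 α)) := by
  simp_rw [torusChar_nsmul, ← Finset.mul_sum]
  by_cases h : torusChar v α = 1
  · rw [Set.indicator_of_mem (show α ∈ annihilator v from (torusChar_eq_one_iff v α).1 h)]
    refine tendsto_const_nhds.congr' ?_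
    filter_upwards [eventually_ne_atTop 0] with N hN
    simp [h, hN]
  · rw [Set.indicator_of_notMem (show α ∉ annihilator v from mt (torusChar_eq_one_iff v α).2 h)]
    have hlim : Tendsto (fun N : ℕ ↦ (N : ℝ)⁻¹ * (2 / ‖torusChar v α - 1‖)) atTop (nhds 0) := by
      simpa using tendsto_inv_atTop_nhds_zero_nat (𝕜 := ℝ).mul_const (2 / ‖torusChar v α - 1‖)
    have hle (N : ℕ) : ‖(((N : ℝ)⁻¹ : ℝ) : ℂ) * ∑ n ∈ Finset.range N, torusChar v α ^ n‖ ≤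
        (N : ℝ)⁻¹ * (2 / ‖torusChar v α - 1‖) := by
      rw [norm_mul, geom_sum_eq h, norm_div, Complex.norm_real, Real.norm_of_nonneg (by positivity)]
      gcongr
      calc ‖torusChar v α ^ N - 1‖ ≤ ‖torusChar v α ^ N‖ + ‖(1 : ℂ)‖ := norm_sub_le _ _
        _ = 2 := by rw [norm_pow, norm_torusChar]; norm_num
    simpa using (squeeze_zero (fun _ ↦ norm_nonneg _) hle hlim).pow 2

/-- The sets `⋃ n, (T^{nv})⁻¹ A` are large when the annihilator of `v` has small
spectral mass. -/
lemma IsSpectralMeasure.sq_le_measureReal_iUnion_mul (hT : IsMPAction d T μ)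
    (hA : MeasurableSet A) {σ : Measure (Fin d → AddCircle (1 : ℝ))} [IsFiniteMeasure σ]
    (hσ : IsSpectralMeasure d T μ A σ) (v : Fin d → ℤ) :
    μ.real A ^ 2 ≤ μ.real (⋃ n : ℤ, T (n • v) ⁻¹' A) * σ.real (annihilator v) := by
  set B := ⋃ n : ℤ, T (n • v) ⁻¹' A
  have hB : MeasurableSet B := .iUnion fun n ↦ hT.measurableSet_preimage hA _
  set b : Lp ℝ 2 μ := indicatorConstLp 2 hB (measure_ne_top μ _) 1
  have hb : ‖b‖ ^ 2 = μ.real B := by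
    rw [← real_inner_self_eq_norm_sq, L2.real_inner_indicatorConstLp_one_indicatorConstLp_one,
      Set.inter_self]
  have hlim : Tendsto (fun N : ℕ ↦ ∫ α, ‖∑ n ∈ Finset.range N,
      ((N : ℝ)⁻¹ : ℝ) * torusChar (n • v) α‖ ^ 2 ∂σ) atTop (nhds (σ.real (annihilator v))) := by
    rw [← integral_indicator_one (isClosed_annihilator v).measurableSet]
    refine tendsto_integral_of_dominated_convergence 1 (fun N ↦ ?_) (integrable_const 1)
      (fun N ↦ .of_forall fun α ↦ ?_) (.of_forall (tendsto_norm_average_sq v))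
    · refine Continuous.aestronglyMeasurable ?_
      have := fun n : ℕ ↦ continuous_torusChar (n • v)
      fun_prop
    · rw [Real.norm_of_nonneg (by positivity), Pi.one_apply]
      refine pow_le_one₀ (norm_nonneg _) ((norm_sum_le _ _).trans ?_)
      simp_rw [norm_mul, norm_torusChar, Complex.norm_real, mul_one]
      rw [Finset.sum_const, Finset.card_range, Real.norm_of_nonneg (by positivity), nsmul_eq_mul]
      exact mul_inv_le_one
  refine ge_of_tendsto (hlim.const_mul (μ.real B)) ?_
  filter_upwards [eventually_ne_atTop 0] with N hN
  rw [← hσ.norm_sum_sq hT hA (Finset.range N) (fun _ ↦ (N : ℝ)⁻¹) (fun n ↦ n • v), ← hb, ← mul_pow]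
  refine pow_le_pow_left₀ measureReal_nonneg (le_trans (le_of_eq ?_) (real_inner_le_norm _ _)) 2
  have hterm (n : ℕ) : inner ℝ b (translatedIndicator hT hA (n • v)) = μ.real A := by
    have hsub : T (n • v) ⁻¹' A ⊆ B := by
      rw [← natCast_zsmul]
      exact Set.subset_iUnion (fun n : ℤ ↦ T (n • v) ⁻¹' A) n
    rw [translatedIndicator, L2.real_inner_indicatorConstLp_one_indicatorConstLp_one,
      Set.inter_eq_self_of_subset_right hsub, (hT.2.2 _).measureReal_preimage hA.nullMeasurableSet]
  simp_rw [inner_sum, real_inner_smul_right, hterm]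
  simp [hN]

end Koopman

section Ergodic

variable {X : Type} [MeasurableSpace X] {d : ℕ} {T : (Fin d → ℤ) → X → X} {μ : Measure X}
  {A : Set X}

lemma IsErgodicAction.exists_ae_eq_const [IsProbabilityMeasure μ] (hT : IsErgodicAction d T μ)
    {g : X → ℝ} (hg : Measurable g) (hinv : ∀ v, g ∘ T v =ᵐ[μ] g) :
    ∃ c, g =ᵐ[μ] Function.const X c := by
  refine exists_eventuallyEq_const_of_forall_separating MeasurableSet fun U hU ↦ ?_
  have hs : MeasurableSet (g ⁻¹' U) := hg hU
  have h := hT.2 (g ⁻¹' U) hs fun v ↦ by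
    rw [measure_symmDiff_eq_zero_iff]
    exact (hinv v).mono fun x hx ↦ congrArg (· ∈ U) hx
  rcases h with h | h
  · exact .inr (measure_eq_zero_iff_ae_notMem.1 h)
  · exact .inl ((mem_ae_iff_prob_eq_one hs).2 h)

/-- A `koopman`-invariant element of `L²` is a multiple of the constant function `1`. -/
lemma IsErgodicAction.exists_eq_smul_of_koopman_eq [IsProbabilityMeasure μ]
    (hT : IsErgodicAction d T μ) {h : Lp ℝ 2 μ} (hinv : ∀ v, koopman hT.1 v h = h) :
    ∃ c : ℝ, h = c • indicatorConstLp 2 MeasurableSet.univ (measure_ne_top μ _) 1 := by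
  obtain ⟨c, hc⟩ := hT.exists_ae_eq_const (Lp.stronglyMeasurable h).measurable fun v ↦ by
    have h1 := Lp.coeFn_compMeasurePreserving h (hT.1.2.2 v)
    have h2 : Lp.compMeasurePreserving (T v) (hT.1.2.2 v) h = h := hinv v
    rw [h2] at h1
    exact h1.symm
  refine ⟨c, Lp.ext ?_⟩
  filter_upwards [hc, Lp.coeFn_smul c (indicatorConstLp (μ := μ) 2 MeasurableSet.univ
    (measure_ne_top μ _) (1 : ℝ)), indicatorConstLp_coeFn (p := 2) (μ := μ)
    (hs := MeasurableSet.univ) (hμs := measure_ne_top μ _) (c := (1 : ℝ))] with x h1 h2 h3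
  rw [h1, h2, Pi.smul_apply, h3]
  simp

lemma exists_mem_closure_convexHull_koopman_eq [IsFiniteMeasure μ] (hT : IsMPAction d T μ)
    (hA : MeasurableSet A) :
    ∃ h ∈ closure (convexHull ℝ (Set.range (translatedIndicator hT hA))),
      ∀ v, koopman hT v h = h := by
  set C := convexHull ℝ (Set.range (translatedIndicator hT hA))
  have hC : Convex ℝ (closure C) := (convex_convexHull ℝ _).closure
  obtain ⟨h, hh, hmin⟩ := exists_norm_eq_iInf_of_complete_convex
    ((Set.range_nonempty _).convexHull.closure) isClosed_closure.isComplete hC 0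
  rw [norm_eq_iInf_iff_real_inner_le_zero hC hh] at hmin
  refine ⟨h, hh, fun v ↦ ?_⟩
  have hmaps : Set.MapsTo (koopman hT v) C C := by
    refine Set.mapsTo_iff_image_subset.2 ?_
    have himg := (koopman hT v).toLinearMap.image_convexHull
      (Set.range (translatedIndicator hT hA))
    refine himg.trans_subset (convexHull_mono ?_)
    rintro _ ⟨_, ⟨w, rfl⟩, rfl⟩
    exact ⟨v + w, (koopman_translatedIndicator hT hA v w).symm⟩
  have hmem : koopman hT v h ∈ closure C :=
    (hmaps.closure (koopman hT v).continuous) hh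
  have hle := hmin _ hmem
  rw [zero_sub, inner_neg_left, inner_sub_right, real_inner_self_eq_norm_sq] at hle
  have hsq := norm_sub_sq_real (koopman hT v h) h
  rw [(koopman hT v).norm_map, real_inner_comm] at hsq
  have : ‖koopman hT v h - h‖ ^ 2 = 0 := le_antisymm (by linarith) (sq_nonneg _)
  exact sub_eq_zero.1 (norm_eq_zero.1 (pow_eq_zero_iff two_ne_zero |>.1 this))

/-- For an ergodic action, the atom at `0` of the spectral measure of `A` has mass at most
`μ(A)²`. -/
lemma IsSpectralMeasure.measureReal_singleton_zero_le [IsProbabilityMeasure μ]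
    (hT : IsErgodicAction d T μ) (hA : MeasurableSet A)
    {σ : Measure (Fin d → AddCircle (1 : ℝ))} [IsFiniteMeasure σ]
    (hσ : IsSpectralMeasure d T μ A σ) : σ.real {0} ≤ μ.real A ^ 2 := by
  obtain ⟨h, hh, hinv⟩ := exists_mem_closure_convexHull_koopman_eq hT.1 hA
  obtain ⟨c, hc⟩ := hT.exists_eq_smul_of_koopman_eq hinv
  set e : Lp ℝ 2 μ := indicatorConstLp 2 MeasurableSet.univ (measure_ne_top μ _) 1
  have he : inner ℝ e e = (1 : ℝ) := by
    rw [L2.real_inner_indicatorConstLp_one_indicatorConstLp_one]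
    simp
  have hconv {f : Lp ℝ 2 μ}
      (hf : f ∈ convexHull ℝ (Set.range (translatedIndicator hT.1 hA))) :
      inner ℝ e f = μ.real A ∧ σ.real {0} ≤ ‖f‖ ^ 2 := by
    obtain ⟨ι, _, a, z, -, ha, hz, rfl⟩ := mem_convexHull_iff_exists_fintype.1 hf
    choose w hw using hz
    obtain rfl : (fun i ↦ translatedIndicator hT.1 hA (w i)) = z := funext hw
    constructor
    · have hterm (v : Fin d → ℤ) : inner ℝ e (translatedIndicator hT.1 hA v) = μ.real A := by
        rw [translatedIndicator, L2.real_inner_indicatorConstLp_one_indicatorConstLp_one,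
          Set.univ_inter, (hT.1.2.2 _).measureReal_preimage hA.nullMeasurableSet]
      simp_rw [inner_sum, real_inner_smul_right, hterm, ← Finset.sum_mul, ha, one_mul]
    · rw [hσ.norm_sum_sq, ← integral_indicator_one (measurableSet_singleton _)]
      have hcont : Continuous fun α ↦ ‖∑ i, (a i : ℂ) * torusChar (w i) α‖ ^ 2 := by
        have := fun i ↦ continuous_torusChar (w i)
        fun_prop
      refine integral_mono ((integrable_const 1).indicator (measurableSet_singleton _))
        (hcont.integrable_of_hasCompactSupport (HasCompactSupport.of_compactSpace _)) fun α ↦ ?_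
      by_cases hα : α = 0
      · subst hα
        simp [torusChar_zero_right, ← Complex.ofReal_sum, ha]
      · rw [Set.indicator_of_notMem (by simpa using hα)]
        positivity
  have hclosed : IsClosed {f : Lp ℝ 2 μ | inner ℝ e f = μ.real A ∧ σ.real {0} ≤ ‖f‖ ^ 2} :=
    (isClosed_eq (continuous_const.inner continuous_id) continuous_const).inter
      (isClosed_le continuous_const (continuous_norm.pow 2))
  obtain ⟨h1, h2⟩ := hclosed.closure_subset_iff.2 (fun f hf ↦ hconv hf) hh
  rw [hc, real_inner_smul_right, he, mul_one] at h1
  rwa [hc, ← real_inner_self_eq_norm_sq, real_inner_smul_left, real_inner_smul_right, he, mul_one,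
    ← sq, h1] at h2

end Ergodic

section MomentCurve

/-- The point `(1, t, …, t^{d-1})` of the moment curve. -/
def momentVec (d : ℕ) (t : ℤ) : Fin d → ℤ := fun i ↦ t ^ (i : ℕ)

lemma isPrimitiveVec_momentVec {d : ℕ} (hd : 1 ≤ d) (t : ℤ) : IsPrimitiveVec (momentVec d t) := by
  have h : Finset.univ.gcd (momentVec d t) ∣ momentVec d t ⟨0, hd⟩ :=
    Finset.gcd_dvd (Finset.mem_univ _)
  rw [IsPrimitiveVec, ← Finset.normalize_gcd]
  exact normalize_eq_one.2 (isUnit_of_dvd_one (by simpa [momentVec] using h))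

/-- A bound for the determinants of the Vandermonde matrices with nodes in `{0, …, N - 1}`. -/
def vandermondeBound (d N : ℕ) : ℕ :=
  ∑ s : Fin d → Fin N, (Matrix.vandermonde fun i ↦ ((s i : ℕ) : ℤ)).det.natAbs

lemma det_smul_eq_zero_of_mulVec {d : ℕ} {G : Type*} [AddCommGroup G]
    (M : Matrix (Fin d) (Fin d) ℤ) (α : Fin d → G) (h : ∀ i, ∑ j, M i j • α j = 0) :
    M.det • α = 0 := by
  funext k
  have hadj : ∑ i, M.adjugate k i • ∑ j, M i j • α j = M.det • α k := by
    simp_rw [Finset.smul_sum, smul_smul]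
    rw [Finset.sum_comm]
    simp_rw [← Finset.sum_smul, ← Matrix.mul_apply, Matrix.adjugate_mul]
    simp [Matrix.smul_apply, Matrix.one_apply, ite_smul]
  simpa [h] using hadj.symm

open Classical in
lemma card_filter_mem_annihilator_le {d N M : ℕ} (hM : vandermondeBound d N ≤ M)
    {α : Fin d → AddCircle (1 : ℝ)} (hα : α ≠ 0) (hαM : α ∉ ratTorsion d M) :
    ((Finset.range N).filter fun t : ℕ ↦ α ∈ annihilator (momentVec d t)).card ≤ d := by
  by_contra! hcard
  obtain ⟨s, hs, hsd⟩ := Finset.exists_subset_card_eq hcard.le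
  have hmem (i : Fin d) := Finset.mem_filter.1 (hs (s.orderEmbOfFin_mem hsd i))
  set t : Fin d → Fin N := fun i ↦ ⟨s.orderEmbOfFin hsd i, Finset.mem_range.1 (hmem i).1⟩
  have hinj : Function.Injective fun i ↦ ((t i : ℕ) : ℤ) := fun i j hij ↦
    (s.orderEmbOfFin hsd).injective (Int.natCast_inj.1 hij)
  have hdet := Matrix.det_vandermonde_ne_zero_iff.2 hinj
  refine hαM ⟨hα, _, Int.natAbs_pos.2 hdet, le_trans ?_ hM, ?_⟩
  · exact Finset.single_le_sum
      (f := fun s : Fin d → Fin N ↦ (Matrix.vandermonde fun i ↦ ((s i : ℕ) : ℤ)).det.natAbs)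
      (fun _ _ ↦ Nat.zero_le _) (Finset.mem_univ t)
  · have h0 := det_smul_eq_zero_of_mulVec (Matrix.vandermonde fun i ↦ ((t i : ℕ) : ℤ)) α
      fun i ↦ by simpa [annihilator, momentVec, Matrix.vandermonde_apply] using (hmem i).2
    rw [← natCast_zsmul, Int.natCast_natAbs]
    rcases abs_choice (Matrix.vandermonde fun i ↦ ((t i : ℕ) : ℤ)).det with h | h <;>
      rw [h] <;> simp [h0]

lemma measurableSet_ratTorsion (d M : ℕ) : MeasurableSet (ratTorsion d M) := by
  have h : ratTorsion d M = {0}ᶜ ∩ ⋃ q ∈ Finset.Icc 1 M, {α | q • α = 0} := by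
    ext α
    simp [ratTorsion, and_assoc]
  rw [h]
  refine (measurableSet_singleton _).compl.inter (Finset.measurableSet_biUnion _ fun q _ ↦ ?_)
  exact (isClosed_eq (by fun_prop) continuous_const).measurableSet

/-- The average over the moment curve of the spectral masses of the punctured annihilators. -/
lemma sum_measureReal_annihilator_diff_le {d N M : ℕ} (hM : vandermondeBound d N ≤ M)
    (σ : Measure (Fin d → AddCircle (1 : ℝ))) [IsFiniteMeasure σ] :
    ∑ t ∈ Finset.range N, σ.real (annihilator (momentVec d t) \ {0}) ≤
      N * σ.real (ratTorsion d M) + d * σ.real Set.univ := by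
  classical
  have hmeas (t : ℕ) : MeasurableSet (annihilator (momentVec d t) \ {0}) :=
    (isClosed_annihilator _).measurableSet.diff (measurableSet_singleton _)
  have hint {s : Set (Fin d → AddCircle (1 : ℝ))} (hs : MeasurableSet s) :
      Integrable (s.indicator (1 : (Fin d → AddCircle (1 : ℝ)) → ℝ)) σ := (integrable_const 1).indicator hs
  have hrat := measurableSet_ratTorsion d M
  calc ∑ t ∈ Finset.range N, σ.real (annihilator (momentVec d t) \ {0})
      = ∫ α, ∑ t ∈ Finset.range N,
          (annihilator (momentVec d t) \ {0}).indicator (1 : (Fin d → AddCircle (1 : ℝ)) → ℝ) α ∂σ := by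
        rw [integral_finsetSum _ fun t _ ↦ hint (hmeas t)]
        simp_rw [integral_indicator_one (hmeas _)]
    _ ≤ ∫ α, (N * (ratTorsion d M).indicator (1 : (Fin d → AddCircle (1 : ℝ)) → ℝ) α + d) ∂σ := by
        refine integral_mono (integrable_finsetSum _ fun t _ ↦ hint (hmeas t))
          (((hint hrat).const_mul _).add (integrable_const _)) fun α ↦ ?_
        by_cases hα : α = 0
        · simp only [hα, Set.mem_sdiff, Set.mem_singleton_iff, not_true_eq_false, and_false,
            not_false_eq_true, Set.indicator_of_notMem, Finset.sum_const_zero]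
          exact add_nonneg (mul_nonneg N.cast_nonneg
            (Set.indicator_nonneg (fun _ _ ↦ zero_le_one) _)) d.cast_nonneg
        · have hsum : ∑ t ∈ Finset.range N,
              (annihilator (momentVec d t) \ {0}).indicator (1 : (Fin d → AddCircle (1 : ℝ)) → ℝ) α =
              ((Finset.range N).filter fun t : ℕ ↦ α ∈ annihilator (momentVec d t)).card := by
            simp [Set.indicator_apply, hα]
          simp only [hsum]
          by_cases hαM : α ∈ ratTorsion d M
          · rw [Set.indicator_of_mem hαM, Pi.one_apply, mul_one]
            have : ((Finset.range N).filter
                fun t : ℕ ↦ α ∈ annihilator (momentVec d t)).card ≤ N :=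
              (Finset.card_filter_le _ _).trans (Finset.card_range N).le
            exact (Nat.cast_le.2 this).trans (le_add_of_nonneg_right d.cast_nonneg)
          · rw [Set.indicator_of_notMem hαM, mul_zero, zero_add]
            exact_mod_cast card_filter_mem_annihilator_le hM hα hαM
    _ = N * σ.real (ratTorsion d M) + d * σ.real Set.univ := by
        rw [integral_add ((hint hrat).const_mul _) (integrable_const _), integral_const_mul,
          integral_indicator_one hrat, integral_const, smul_eq_mul, mul_comm (σ.real _)]

end MomentCurve

/-- **Directional dichotomy.** For all `δ, ε > 0` there are a positive integer
`M = M(d, δ, ε)` and a positive real `κ = κ(d, δ, ε)` such that: if `T` is an ergodic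
measure-preserving `ℤ^d`-action on a probability space `(X, μ)`, `A` is measurable with
`μ(A) ≥ δ` and spectral measure `σ`, and `σ(Rat(M)) < κ`, then there is a primitive
vector `v ∈ ℤ^d` with `μ(⋃_{n ∈ ℤ} (T^{nv})⁻¹ A) > 1 - ε`. -/
theorem directional_dichotomy
    (d : ℕ) (hd : 1 ≤ d) (δ ε : ℝ) (hδ : 0 < δ) (hε : 0 < ε) :
    ∃ M : ℕ, 0 < M ∧ ∃ κ : ℝ, 0 < κ ∧
      ∀ (X : Type) (_ : MeasurableSpace X) (μ : Measure X) (_ : IsProbabilityMeasure μ)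
        (T : (Fin d → ℤ) → X → X), IsErgodicAction d T μ →
        ∀ A : Set X, MeasurableSet A → δ ≤ (μ A).toReal →
          ∀ σ : Measure (Fin d → AddCircle (1 : ℝ)), IsFiniteMeasure σ →
            IsSpectralMeasure d T μ A σ →
            (σ (ratTorsion d M)).toReal < κ →
            ∃ v : Fin d → ℤ, IsPrimitiveVec v ∧
              1 - ε < (μ (⋃ n : ℤ, T (n • v) ⁻¹' A)).toReal := by
  have hη : 0 < ε * δ ^ 2 := by positivity
  obtain ⟨N, hN⟩ := exists_nat_gt (d / (ε * δ ^ 2 / 2))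
  have hNpos : (0 : ℝ) < N := lt_of_le_of_lt (by positivity) hN
  rw [div_lt_iff₀ (by positivity)] at hN
  refine ⟨vandermondeBound d N + 1, Nat.succ_pos _, ε * δ ^ 2 / 2, by positivity, ?_⟩
  intro X _ μ _ T hT A hA hδA σ _ hσ hσM
  rw [← measureReal_def] at hδA hσM
  have huniv : σ.real Set.univ ≤ 1 := by
    have h0 := hσ 0
    simp only [Pi.zero_apply, zero_smul, Finset.sum_const_zero, AddCircle.toCircle_zero,
      Circle.coe_one, integral_const, Complex.real_smul, mul_one, Complex.ofReal_inj] at h0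
    rw [← h0, ← measureReal_def]
    exact measureReal_le_one
  obtain ⟨t, -, ht⟩ : ∃ t ∈ Finset.range N,
      σ.real (annihilator (momentVec d t) \ {0}) < ε * δ ^ 2 := by
    refine Finset.exists_lt_of_sum_lt ?_
    calc ∑ t ∈ Finset.range N, σ.real (annihilator (momentVec d t) \ {0})
        ≤ N * σ.real (ratTorsion d (vandermondeBound d N + 1)) + d * σ.real Set.univ :=
          sum_measureReal_annihilator_diff_le (Nat.le_succ _) σ
      _ ≤ N * σ.real (ratTorsion d (vandermondeBound d N + 1)) + d := by
          gcongr
          exact mul_le_of_le_one_right d.cast_nonneg huniv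
      _ < N * (ε * δ ^ 2 / 2) + N * (ε * δ ^ 2 / 2) := by gcongr
      _ = ∑ t ∈ Finset.range N, ε * δ ^ 2 := by
          rw [Finset.sum_const, Finset.card_range, nsmul_eq_mul]
          ring
  refine ⟨momentVec d t, isPrimitiveVec_momentVec hd t, ?_⟩
  rw [← measureReal_def]
  have hCS := hσ.sq_le_measureReal_iUnion_mul hT.1 hA (momentVec d t)
  set b := μ.real (⋃ n : ℤ, T (n • momentVec d t) ⁻¹' A)
  have hb : 0 ≤ b := measureReal_nonneg
  have hann : σ.real (annihilator (momentVec d t)) ≤ (1 + ε) * μ.real A ^ 2 := by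
    have hsub : ({0} : Set (Fin d → AddCircle (1 : ℝ))) ⊆ annihilator (momentVec d t) := by
      simp [annihilator]
    rw [← measureReal_sdiff_add_inter (measurableSet_singleton 0),
      Set.inter_eq_self_of_subset_right hsub]
    have h1 := hσ.measureReal_singleton_zero_le hT hA
    have h2 : ε * δ ^ 2 ≤ ε * μ.real A ^ 2 := by gcongr
    linarith
  have hA2 : 0 < μ.real A ^ 2 := pow_pos (hδ.trans_le hδA) 2
  have h1 : 1 ≤ b * (1 + ε) := by
    refine le_of_mul_le_mul_right ?_ hA2
    nlinarith [mul_le_mul_of_nonneg_left hann hb]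
  by_contra! hle
  nlinarith [mul_le_mul_of_nonneg_right hle (by positivity : 0 ≤ 1 + ε), pow_pos hε 2]
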